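/- arXiv:1604.04561 — 10 statements merged into one kernel-verified Lean document; each statement's English description precedes it below -/
import Mathlib

section
/- Let (X, G, γ) be a normal decomposition system. Let Ω ⊆ X be a convex G-invariant set, let F : X → ℝ be a convex G-invariant function, and let Θ : X → ℝ be Fréchet differentiable. If a ∈ Ω is a local minimizer of x ↦ Θ(x) + F(x) over Ω, then a and −∇Θ(a) commute in (X, G, γ); that is, there exists A ∈ G with a = A(γ(a)) and −∇Θ(a) = A(γ(−∇Θ(a))). -/
open RealInnerProductSpace

/-- If `Θ + F` has a local minimum over a convex set at `a`, with `F` convex, then the derivative of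
`Θ` at `a` is nonnegative in every direction `x - a` with `x` in the set and `F x ≤ F a`. -/
theorem IsLocalMinOn.fderiv_nonneg_of_convexOn_add
    {E : Type*} [NormedAddCommGroup E] [NormedSpace ℝ E] {Ω : Set E} {Θ F : E → ℝ} {a x : E}
    (hmin : IsLocalMinOn (fun y => Θ y + F y) Ω a) (hF : ConvexOn ℝ Ω F)
    (hΘ : DifferentiableAt ℝ Θ a) (ha : a ∈ Ω) (hx : x ∈ Ω) (hxa : F x ≤ F a) :
    0 ≤ fderiv ℝ Θ a (x - a) := by
  have hsub : segment ℝ a x ⊆ Ω := hF.1.segment_subset ha hx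
  have hseg : IsLocalMinOn Θ (segment ℝ a x) a := by
    filter_upwards [hmin.on_subset hsub, self_mem_nhdsWithin] with y hy hys
    have hFy : F y ≤ F a := (hF.le_on_segment ha hx hys).trans (max_le le_rfl hxa)
    linarith
  exact hseg.hasFDerivWithinAt_nonneg hΘ.hasFDerivAt.hasFDerivWithinAt
    (sub_mem_posTangentConeAt_of_segment_subset subset_rfl)

section NormalDecomposition

variable {X : Type*} [NormedAddCommGroup X] [InnerProductSpace ℝ X]
  {G : Subgroup (X ≃ₗᵢ[ℝ] X)} {γ : X → X}

/-- The norm is preserved by the map of a normal decomposition system. -/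
theorem norm_map_of_decomp (hγdecomp : ∀ x : X, ∃ A ∈ G, x = A (γ x)) (x : X) :
    ‖γ x‖ = ‖x‖ := by
  obtain ⟨A, -, hA⟩ := hγdecomp x
  rw [← A.norm_map (γ x), ← hA]

/-- In a normal decomposition system, `⟪A x, γ w⟫ ≤ ⟪γ x, γ w⟫` for every group element `A`. -/
theorem inner_apply_map_le
    (hγinv : ∀ (x : X), ∀ A ∈ G, γ (A x) = γ x)
    (hγdecomp : ∀ x : X, ∃ A ∈ G, x = A (γ x))
    (hγineq : ∀ x w : X, ⟪x, w⟫ ≤ ⟪γ x, γ w⟫)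
    {A : X ≃ₗᵢ[ℝ] X} (hA : A ∈ G) (x w : X) : ⟪A x, γ w⟫ ≤ ⟪γ x, γ w⟫ := by
  have hidem : γ (γ w) = γ w := by
    obtain ⟨B, hB, hw⟩ := hγdecomp w
    rw [← hγinv (γ w) B hB, ← hw]
  simpa only [hγinv x A hA, hidem] using hγineq (A x) (γ w)

/-- In a normal decomposition system, elements attaining equality in `⟪a, b⟫ ≤ ⟪γ a, γ b⟫`
commute. -/
theorem exists_common_decomp_of_inner_map_le
    (hγinv : ∀ (x : X), ∀ A ∈ G, γ (A x) = γ x)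
    (hγdecomp : ∀ x : X, ∃ A ∈ G, x = A (γ x))
    (hγineq : ∀ x w : X, ⟪x, w⟫ ≤ ⟪γ x, γ w⟫)
    {a b : X} (hab : ⟪γ a, γ b⟫ ≤ ⟪a, b⟫) :
    ∃ A ∈ G, a = A (γ a) ∧ b = A (γ b) := by
  have hab_eq : ⟪a, b⟫ = ⟪γ a, γ b⟫ := (hγineq a b).antisymm hab
  have hnorm := norm_map_of_decomp hγdecomp
  obtain ⟨A, hA, hz⟩ := hγdecomp (a + b)
  have hsymm : A.symm ∈ G := inv_mem hA
  have hz_symm : A.symm a + A.symm b = γ (a + b) := by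
    rw [← map_add, LinearIsometryEquiv.symm_apply_eq]; exact hz
  have hle := inner_apply_map_le hγinv hγdecomp hγineq hsymm
  have hsum : γ a + γ b = γ (a + b) := by
    have h1 := hle a (a + b)
    have h2 := hle b (a + b)
    have h3 : ⟪A.symm a, γ (a + b)⟫ + ⟪A.symm b, γ (a + b)⟫ = ‖a + b‖ ^ 2 := by
      rw [← inner_add_left, hz_symm, real_inner_self_eq_norm_sq, hnorm]
    have h4 : ‖γ a + γ b‖ ^ 2 = ‖a + b‖ ^ 2 := by
      rw [norm_add_sq_real, norm_add_sq_real, hnorm, hnorm, hab_eq]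
    have h5 := norm_sub_sq_real (γ a + γ b) (γ (a + b))
    rw [h4, hnorm (a + b), inner_add_left] at h5
    have h6 : ‖γ a + γ b - γ (a + b)‖ ^ 2 ≤ 0 := by linarith
    rw [← sub_eq_zero, ← norm_eq_zero]
    exact pow_eq_zero_iff two_ne_zero |>.1 (h6.antisymm (sq_nonneg _))
  have hAa : A.symm a = γ a := by
    have h1 := hle a b
    have h2 : ⟪A.symm a, γ a⟫ + ⟪A.symm a, γ b⟫ = ‖a‖ ^ 2 + ⟪a, b⟫ := by
      rw [← inner_add_right, hsum, ← hz_symm, ← map_add, A.symm.inner_map_map, inner_add_right,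
        real_inner_self_eq_norm_sq]
    have h3 := norm_sub_sq_real (A.symm a) (γ a)
    rw [A.symm.norm_map, hnorm] at h3
    have h4 : ‖A.symm a - γ a‖ ^ 2 ≤ 0 := by linarith
    rw [← sub_eq_zero, ← norm_eq_zero]
    exact pow_eq_zero_iff two_ne_zero |>.1 (h4.antisymm (sq_nonneg _))
  have hAb : A.symm b = γ b := by
    rw [← hsum, hAa] at hz_symm
    exact add_left_cancel hz_symm
  exact ⟨A, hA, A.symm_apply_eq.1 hAa, A.symm_apply_eq.1 hAb⟩

end NormalDecomposition

/-- **Commutation principle in a normal decomposition system (Theorem 3 of the paper).**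
If `(X, G, γ)` is a normal decomposition system, `Ω` a convex `G`-invariant set,
`F` a convex `G`-invariant function, `Θ` Fréchet differentiable, and `a ∈ Ω` is a
local minimizer of `Θ + F` over `Ω`, then `a` and `-∇Θ(a)` commute in `(X, G, γ)`. -/
theorem commutation_principle_NDS
    {X : Type*} [NormedAddCommGroup X] [InnerProductSpace ℝ X] [FiniteDimensional ℝ X]
    (G : Subgroup (X ≃ₗᵢ[ℝ] X)) (γ : X → X)
    (hGclosed : IsClosed ((fun A : X ≃ₗᵢ[ℝ] X =>
      (A.toLinearIsometry.toContinuousLinearMap : X →L[ℝ] X)) '' (G : Set (X ≃ₗᵢ[ℝ] X))))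
    (hγinv : ∀ (x : X), ∀ A ∈ G, γ (A x) = γ x)
    (hγdecomp : ∀ x : X, ∃ A ∈ G, x = A (γ x))
    (hγineq : ∀ x w : X, ⟪x, w⟫ ≤ ⟪γ x, γ w⟫)
    (Ω : Set X) (hΩconv : Convex ℝ Ω)
    (hΩinv : ∀ A ∈ G, ∀ x ∈ Ω, A x ∈ Ω)
    (F : X → ℝ) (hFconv : ConvexOn ℝ Set.univ F)
    (hFinv : ∀ (x : X), ∀ A ∈ G, F (A x) = F x)
    (Θ : X → ℝ) (hΘ : Differentiable ℝ Θ)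
    (a : X) (ha : a ∈ Ω)
    (hmin : IsLocalMinOn (fun x => Θ x + F x) Ω a) :
    ∃ A ∈ G, a = A (γ a) ∧ -gradient Θ a = A (γ (-gradient Θ a)) := by
  apply exists_common_decomp_of_inner_map_le hγinv hγdecomp hγineq
  obtain ⟨B, hB, hBb⟩ := hγdecomp (-gradient Θ a)
  obtain ⟨C, hC, hCa⟩ := hγdecomp a
  have hBγ : B (γ a) = (B * C⁻¹) a := by
    change B (γ a) = B (C.symm a)
    rw [C.symm_apply_eq.2 hCa]
  have hBC : B * C⁻¹ ∈ G := mul_mem hB (inv_mem hC)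
  have hmem : B (γ a) ∈ Ω := hBγ ▸ hΩinv _ hBC a ha
  have hF_eq : F (B (γ a)) = F a := hBγ ▸ hFinv a _ hBC
  have hnonneg := hmin.fderiv_nonneg_of_convexOn_add (hFconv.subset (Set.subset_univ Ω) hΩconv)
    (hΘ a) ha hmem hF_eq.le
  rw [← inner_gradient_left, inner_sub_right] at hnonneg
  rw [← B.inner_map_map, ← hBb, inner_neg_right, inner_neg_right, real_inner_comm,
    real_inner_comm _ a]
  linarith
end

section
/- Let (X, G, γ) be a normal decomposition system. For any two elements x, w ∈ X, the equality ⟨x, w⟩ = ⟨γ(x), γ(w)⟩ holds if and only if there exists A ∈ G such that x = A(γ(x)) and w = A(γ(w)). -/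
open RealInnerProductSpace

/-- Two vectors of equal norm are equal once their inner product attains the squared norm. -/
theorem eq_of_inner_self_le {X : Type*} [NormedAddCommGroup X] [InnerProductSpace ℝ X]
    {u v : X} (huv : ⟪u, u⟫ = ⟪v, v⟫) (hle : ⟪v, v⟫ ≤ ⟪u, v⟫) : u = v := by
  have hsub : ⟪u - v, u - v⟫ ≤ 0 := by
    rw [real_inner_sub_sub_self]
    linarith
  exact sub_eq_zero.mp (real_inner_self_nonpos.mp hsub)

/-- In a normal decomposition system `(X, G, γ)`, `⟨x, w⟩ = ⟨γ(x), γ(w)⟩` holds iff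
there exists `A ∈ G` with `x = A γ(x)` and `w = A γ(w)` (Proposition 4, second part). -/
theorem NDS_inner_eq_iff_commute
    {X : Type*} [NormedAddCommGroup X] [InnerProductSpace ℝ X] [FiniteDimensional ℝ X]
    (G : Subgroup (X ≃ₗᵢ[ℝ] X)) (γ : X → X)
    (hGclosed : IsClosed ((fun A : X ≃ₗᵢ[ℝ] X =>
      (A.toLinearIsometry.toContinuousLinearMap : X →L[ℝ] X)) '' (G : Set (X ≃ₗᵢ[ℝ] X))))
    (hγinv : ∀ (x : X), ∀ A ∈ G, γ (A x) = γ x)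
    (hγdecomp : ∀ x : X, ∃ A ∈ G, x = A (γ x))
    (hγineq : ∀ x w : X, ⟪x, w⟫ ≤ ⟪γ x, γ w⟫)
    (x w : X) :
    ⟪x, w⟫ = ⟪γ x, γ w⟫ ↔ ∃ A ∈ G, x = A (γ x) ∧ w = A (γ w) := by
  constructor
  · intro h
    have hself : ∀ y : X, ⟪γ y, γ y⟫ = ⟪y, y⟫ := fun y ↦ by
      obtain ⟨A, -, hy⟩ := hγdecomp y
      rw [← A.inner_map_map (γ y) (γ y), ← hy]
    have hidem : ∀ y : X, γ (γ y) = γ y := fun y ↦ by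
      obtain ⟨A, hA, hy⟩ := hγdecomp y
      rw [← hγinv (γ y) A hA, ← hy]
    -- Equality forces `γ` to be additive on the pair `x, w`.
    have hadd : γ x + γ w = γ (x + w) := by
      have hx := hγineq x (x + w)
      have hw := hγineq w (x + w)
      apply eq_of_inner_self_le
      · rw [hself, real_inner_add_add_self, real_inner_add_add_self, hself, hself, h]
      · rw [hself, inner_add_left, inner_add_left]
        linarith
    obtain ⟨A, hA, hz⟩ := hγdecomp (x + w)
    have hAx : A (γ x) = x := by
      have hinner : ⟪A (γ x), x + w⟫ = ⟪γ x, γ x + γ w⟫ := by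
        rw [hadd, ← A.inner_map_map (γ x), ← hz]
      have hle := hγineq (A (γ x)) w
      rw [hγinv _ A hA, hidem] at hle
      rw [inner_add_right, inner_add_right, hself] at hinner
      apply eq_of_inner_self_le
      · rw [A.inner_map_map, hself]
      · linarith
    refine ⟨A, hA, hAx.symm, ?_⟩
    rw [← hadd, map_add, hAx] at hz
    exact add_left_cancel hz
  · rintro ⟨A, -, hx, hw⟩
    rw [← A.inner_map_map (γ x), ← hx, ← hw]
end

section
/- Let (X, G, γ) be a normal decomposition system, let Ω ⊆ X be a convex G-invariant set, let F : X → ℝ be a convex G-invariant function, and let H : X → X be an arbitrary map. If a ∈ Ω satisfies the variational inequality ⟨H(a), x − a⟩ + F(x) − F(a) ≥ 0 for all x ∈ Ω, then a and −H(a) commute in (X, G, γ); that is, there exists A ∈ G with a = A(γ(a)) and −H(a) = A(γ(−H(a))). -/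
open RealInnerProductSpace

/-- In a normal decomposition system, two elements attaining equality in `⟪x, w⟫ ≤ ⟪γ x, γ w⟫`
commute. -/
theorem exists_common_decomposition_of_inner_le
    {X : Type*} [NormedAddCommGroup X] [InnerProductSpace ℝ X]
    (G : Subgroup (X ≃ₗᵢ[ℝ] X)) (γ : X → X)
    (hγinv : ∀ (x : X), ∀ A ∈ G, γ (A x) = γ x)
    (hγdecomp : ∀ x : X, ∃ A ∈ G, x = A (γ x))
    (hγineq : ∀ x w : X, ⟪x, w⟫ ≤ ⟪γ x, γ w⟫)
    (a b : X) (hab : ⟪γ a, γ b⟫ ≤ ⟪a, b⟫) :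
    ∃ A ∈ G, a = A (γ a) ∧ b = A (γ b) := by
  have hidem (x : X) : γ (γ x) = γ x := by
    obtain ⟨A, hA, hx⟩ := hγdecomp x
    rw [← hγinv (γ x) A hA, ← hx]
  have hnorm (x : X) : ⟪γ x, γ x⟫ = ⟪x, x⟫ := by
    obtain ⟨A, -, hx⟩ := hγdecomp x
    rw [← A.inner_map_map (γ x) (γ x), ← hx]
  obtain ⟨A, hA, hsum⟩ := hγdecomp (a + b)
  obtain ⟨u, rfl⟩ := A.surjective a
  obtain ⟨v, rfl⟩ := A.surjective b
  have hg : γ (A u + A v) = u + v := A.injective (by rw [← hsum, map_add])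
  have hgg : γ (u + v) = u + v := by rw [← hg, hidem]
  have hna := hnorm (A u)
  have hnb := hnorm (A v)
  rw [A.inner_map_map] at hab hna hnb
  rw [hγinv u A hA] at hab hna ⊢
  rw [hγinv v A hA] at hab hnb ⊢
  have h₁ := hγineq (u + v) u
  have h₂ := hγineq (u + v) v
  have haa := hγineq u (γ u)
  have hba := hγineq v (γ u)
  have hbb := hγineq v (γ v)
  have hav := hγineq u (γ v)
  rw [hgg] at h₁ h₂
  rw [hidem] at haa hba hbb hav
  simp only [inner_add_left] at h₁ h₂
  have hcomm := real_inner_comm u v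
  have hcommγ := real_inner_comm (γ u) (γ v)
  have eq_of_inner (x y : X) (hn : ⟪y, y⟫ = ⟪x, x⟫) (h : ⟪y, y⟫ ≤ ⟪x, y⟫) : x = y := by
    rw [← sub_eq_zero, ← inner_self_eq_zero (𝕜 := ℝ)]
    refine le_antisymm ?_ real_inner_self_nonneg
    rw [real_inner_sub_sub_self]
    linarith
  exact ⟨A, hA, congrArg A (eq_of_inner _ _ hna (by linarith)),
    congrArg A (eq_of_inner _ _ hnb (by linarith))⟩

/-- **Variational inequality version of the commutation principle in a normal decomposition
system (Theorem 6 of the paper).** If `Ω` is convex and `G`-invariant, `F` is convex and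
`G`-invariant, and `a ∈ Ω` solves the variational inequality `VI(H, Ω, F)`, then `a` and
`-H(a)` commute in `(X, G, γ)`. -/
theorem NDS_variational_inequality_commute
    {X : Type*} [NormedAddCommGroup X] [InnerProductSpace ℝ X] [FiniteDimensional ℝ X]
    (G : Subgroup (X ≃ₗᵢ[ℝ] X)) (γ : X → X)
    (hGclosed : IsClosed ((fun A : X ≃ₗᵢ[ℝ] X =>
      (A.toLinearIsometry.toContinuousLinearMap : X →L[ℝ] X)) '' (G : Set (X ≃ₗᵢ[ℝ] X))))
    (hγinv : ∀ (x : X), ∀ A ∈ G, γ (A x) = γ x)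
    (hγdecomp : ∀ x : X, ∃ A ∈ G, x = A (γ x))
    (hγineq : ∀ x w : X, ⟪x, w⟫ ≤ ⟪γ x, γ w⟫)
    (Ω : Set X) (hΩconv : Convex ℝ Ω)
    (hΩinv : ∀ A ∈ G, ∀ x ∈ Ω, A x ∈ Ω)
    (F : X → ℝ) (hFconv : ConvexOn ℝ Set.univ F)
    (hFinv : ∀ (x : X), ∀ A ∈ G, F (A x) = F x)
    (H : X → X)
    (a : X) (ha : a ∈ Ω)
    (hVI : ∀ x ∈ Ω, 0 ≤ ⟪H a, x - a⟫ + F x - F a) :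
    ∃ A ∈ G, a = A (γ a) ∧ -H a = A (γ (-H a)) := by
  refine exists_common_decomposition_of_inner_le G γ hγinv hγdecomp hγineq a (-H a) ?_
  obtain ⟨B, hB, hb⟩ := hγdecomp (-H a)
  obtain ⟨C, hC, hc⟩ := hγdecomp a
  have hmem : B * C⁻¹ ∈ G := G.mul_mem hB (G.inv_mem hC)
  have hx : (B * C⁻¹) a = B (γ a) := by
    change B (C.symm a) = B (γ a)
    rw [C.symm_apply_eq.mpr hc]
  have hvi := hVI _ (hΩinv _ hmem a ha)
  rw [hFinv a _ hmem, hx, inner_sub_right] at hvi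
  have hinner : ⟪γ a, γ (-H a)⟫ = ⟪B (γ a), -H a⟫ := by
    conv_rhs => rw [hb]
    rw [B.inner_map_map]
  rw [hinner, inner_neg_right, inner_neg_right, real_inner_comm (H a), real_inner_comm (H a)]
  linarith
end

section
/- Let (X, G, γ) be a normal decomposition system, let K be a closed convex cone in X that is G-invariant, and let H : X → X be an arbitrary map. If a solves the cone complementarity problem CP(H, K), i.e., a ∈ K, H(a) ∈ K*, and ⟨a, H(a)⟩ = 0, then a and −H(a) commute in (X, G, γ); that is, there exists A ∈ G with a = A(γ(a)) and −H(a) = A(γ(−H(a))). -/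
open RealInnerProductSpace

section NormalDecomposition

variable {X : Type*} [NormedAddCommGroup X] [InnerProductSpace ℝ X]
  {G : Subgroup (X ≃ₗᵢ[ℝ] X)} {γ : X → X}

/-- Two vectors with `⟪u, v⟫ ≥ ‖v‖²` and equal norms coincide. -/
lemma eq_of_inner_self_le_inner {u v : X} (hnorm : ⟪u, u⟫ = ⟪v, v⟫) (h : ⟪v, v⟫ ≤ ⟪u, v⟫) :
    u = v := by
  have hle : ⟪u - v, u - v⟫ ≤ 0 := by
    rw [real_inner_sub_sub_self]
    linarith
  exact sub_eq_zero.mp (real_inner_self_nonpos.mp hle)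

/-- In a normal decomposition system, equality in `⟪a, b⟫ ≤ ⟪γ a, γ b⟫` forces `a` and `b`
to commute. -/
theorem exists_mem_eq_apply_of_inner_eq
    (hγinv : ∀ (x : X), ∀ A ∈ G, γ (A x) = γ x)
    (hγdecomp : ∀ x : X, ∃ A ∈ G, x = A (γ x))
    (hγineq : ∀ x w : X, ⟪x, w⟫ ≤ ⟪γ x, γ w⟫)
    {a b : X} (hab : ⟪a, b⟫ = ⟪γ a, γ b⟫) :
    ∃ A ∈ G, a = A (γ a) ∧ b = A (γ b) := by
  have hidem (x : X) : γ (γ x) = γ x := by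
    obtain ⟨A, hA, hx⟩ := hγdecomp x
    rw [← hγinv (γ x) A hA, ← hx]
  have hself (x : X) : ⟪γ x, γ x⟫ = ⟪x, x⟫ := by
    obtain ⟨A, -, hx⟩ := hγdecomp x
    conv_rhs => rw [hx, A.inner_map_map]
  have hadd : γ (a + b) = γ a + γ b := by
    have hexpand : ⟪γ a + γ b, γ a + γ b⟫ = ⟪a + b, a + b⟫ := by
      rw [real_inner_add_add_self, real_inner_add_add_self, hself, hself, hab]
    apply eq_of_inner_self_le_inner
    · rw [hself, hexpand]
    · rw [hexpand, inner_add_right, inner_add_right]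
      exact add_le_add (hγineq _ _) (hγineq _ _)
  obtain ⟨A, hA, hsum⟩ := hγdecomp (a + b)
  rw [hadd, map_add] at hsum
  have hbound (x y : X) : ⟪x, A (γ y)⟫ ≤ ⟪γ x, γ y⟫ := by
    simpa only [hγinv _ A hA, hidem] using hγineq x (A (γ y))
  have hAself (x : X) : ⟪x, x⟫ = ⟪A (γ x), A (γ x)⟫ := by
    rw [A.inner_map_map, hself]
  refine ⟨A, hA, eq_of_inner_self_le_inner (hAself a) ?_, eq_of_inner_self_le_inner (hAself b) ?_⟩
  · have h := congrArg (fun z => ⟪a, z⟫) hsum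
    simp only [inner_add_right] at h
    rw [← hAself]
    linarith [hbound a b]
  · have h := congrArg (fun z => ⟪b, z⟫) hsum
    simp only [inner_add_right] at h
    rw [← hAself]
    linarith [hbound b a, real_inner_comm a b, real_inner_comm (γ a) (γ b)]

end NormalDecomposition

/-- **Cone complementarity version of the commutation principle in a normal decomposition
system (Corollary 2 of the paper).** If `K` is a closed convex cone that is `G`-invariant
and `a` solves the cone complementarity problem `CP(H, K)` (i.e. `a ∈ K`, `H(a) ∈ K*`,
`⟨a, H(a)⟩ = 0`), then `a` and `-H(a)` commute in `(X, G, γ)`. -/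
theorem NDS_cone_complementarity_commute
    {X : Type*} [NormedAddCommGroup X] [InnerProductSpace ℝ X] [FiniteDimensional ℝ X]
    (G : Subgroup (X ≃ₗᵢ[ℝ] X)) (γ : X → X)
    (hGclosed : IsClosed ((fun A : X ≃ₗᵢ[ℝ] X =>
      (A.toLinearIsometry.toContinuousLinearMap : X →L[ℝ] X)) '' (G : Set (X ≃ₗᵢ[ℝ] X))))
    (hγinv : ∀ (x : X), ∀ A ∈ G, γ (A x) = γ x)
    (hγdecomp : ∀ x : X, ∃ A ∈ G, x = A (γ x))
    (hγineq : ∀ x w : X, ⟪x, w⟫ ≤ ⟪γ x, γ w⟫)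
    (K : Set X) (hKclosed : IsClosed K) (hKconv : Convex ℝ K)
    (hKcone : ∀ x ∈ K, ∀ c : ℝ, 0 < c → c • x ∈ K)
    (hKinv : ∀ A ∈ G, ∀ x ∈ K, A x ∈ K)
    (H : X → X)
    (a : X) (haK : a ∈ K)
    (haH : ∀ x ∈ K, 0 ≤ ⟪H a, x⟫)
    (hcomp : ⟪a, H a⟫ = 0) :
    ∃ A ∈ G, a = A (γ a) ∧ -H a = A (γ (-H a)) := by
  refine exists_mem_eq_apply_of_inner_eq hγinv hγdecomp hγineq (le_antisymm (hγineq _ _) ?_)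
  obtain ⟨A, hA, ha⟩ := hγdecomp a
  obtain ⟨B, hB, hb⟩ := hγdecomp (-H a)
  have hmem : B (γ a) ∈ K := by
    have h := hKinv B hB _ (hKinv A⁻¹ (G.inv_mem hA) a haK)
    rwa [show A⁻¹ a = γ a from A.symm_apply_eq.mpr ha] at h
  calc ⟪γ a, γ (-H a)⟫ = ⟪B (γ a), -H a⟫ := by
        conv_rhs => rw [hb, B.inner_map_map]
    _ ≤ 0 := by
        rw [inner_neg_right, real_inner_comm]
        exact neg_nonpos.mpr (haH _ hmem)
    _ = ⟪a, -H a⟫ := by rw [inner_neg_right, hcomp, neg_zero]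
end

section
/- Let (X, G, γ) be a normal decomposition system and let K be a closed convex cone in X that is G-invariant. If a ∈ K and b ∈ K* satisfy ⟨a, b⟩ = 0, then a and −b commute in (X, G, γ); that is, there exists A ∈ G with a = A(γ(a)) and −b = A(γ(−b)). -/
open RealInnerProductSpace

/-- In a normal decomposition system, equality in `⟪x, w⟫ ≤ ⟪γ x, γ w⟫` forces `x` and `w` to
commute: any `A ∈ G` with `x + w = A (γ (x + w))` decomposes both. -/
theorem exists_simultaneous_decomp_of_inner_eq
    {X : Type*} [NormedAddCommGroup X] [InnerProductSpace ℝ X]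
    (G : Subgroup (X ≃ₗᵢ[ℝ] X)) (γ : X → X)
    (hγinv : ∀ (x : X), ∀ A ∈ G, γ (A x) = γ x)
    (hγdecomp : ∀ x : X, ∃ A ∈ G, x = A (γ x))
    (hγineq : ∀ x w : X, ⟪x, w⟫ ≤ ⟪γ x, γ w⟫)
    {x w : X} (h : ⟪x, w⟫ = ⟪γ x, γ w⟫) :
    ∃ A ∈ G, x = A (γ x) ∧ w = A (γ w) := by
  have hidem (y : X) : γ (γ y) = γ y := by
    obtain ⟨A, hA, hy⟩ := hγdecomp y
    rw [← hγinv (γ y) A hA, ← hy]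
  have hnorm (y : X) : ‖γ y‖ = ‖y‖ := by
    obtain ⟨A, -, hy⟩ := hγdecomp y
    conv_rhs => rw [hy, A.norm_map]
  have eq_of_inner {y z : X} (hn : ‖y‖ = ‖z‖) (hi : ‖z‖ ^ 2 ≤ ⟪y, z⟫) : y = z := by
    have hsq := norm_sub_sq_real y z
    rw [hn] at hsq
    have h0 : ‖y - z‖ ^ 2 = 0 := le_antisymm (by linarith) (sq_nonneg _)
    exact sub_eq_zero.mp (norm_eq_zero.mp (pow_eq_zero_iff two_ne_zero |>.mp h0))
  obtain ⟨A, hA, hxw⟩ := hγdecomp (x + w)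
  obtain ⟨u, rfl⟩ := A.surjective x
  obtain ⟨v, rfl⟩ := A.surjective w
  have huv : u + v = γ (A u + A v) := A.injective (by rw [map_add, ← hxw])
  simp only [hγinv _ A hA] at h ⊢
  rw [A.inner_map_map] at h
  set s := γ (A u + A v)
  have hs : γ s = s := hidem _
  have hsum : γ u + γ v = s := by
    refine eq_of_inner ?_ ?_
    · rw [← sq_eq_sq₀ (norm_nonneg _) (norm_nonneg _), ← huv, norm_add_sq_real,
        norm_add_sq_real, hnorm, hnorm, h]
    · have hu := hγineq u s
      have hv := hγineq v s
      rw [hs] at hu hv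
      calc ‖s‖ ^ 2 = ⟪u + v, s⟫ := by rw [huv, real_inner_self_eq_norm_sq]
        _ = ⟪u, s⟫ + ⟪v, s⟫ := inner_add_left ..
        _ ≤ ⟪γ u, s⟫ + ⟪γ v, s⟫ := add_le_add hu hv
        _ = ⟪γ u + γ v, s⟫ := (inner_add_left ..).symm
  have hu : u = γ u := by
    refine eq_of_inner (hnorm u).symm ?_
    have huv' := hγineq u (γ v)
    rw [hidem] at huv'
    have hus : ⟪u, s⟫ = ‖u‖ ^ 2 + ⟪γ u, γ v⟫ := by
      rw [← huv, inner_add_right, real_inner_self_eq_norm_sq, h]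
    rw [← hsum, inner_add_right] at hus
    rw [hnorm]
    linarith
  have hv : v = γ v := by
    rw [← huv, ← hu] at hsum
    exact (add_left_cancel hsum).symm
  exact ⟨A, hA, congrArg A hu, congrArg A hv⟩

/-- **Remark 8 of the paper.** If `K` is a closed convex cone in `X` that is `G`-invariant,
`a ∈ K`, `b ∈ K*`, and `⟨a, b⟩ = 0`, then `a` and `-b` commute in `(X, G, γ)`. -/
theorem NDS_complementary_pair_commute
    {X : Type*} [NormedAddCommGroup X] [InnerProductSpace ℝ X] [FiniteDimensional ℝ X]
    (G : Subgroup (X ≃ₗᵢ[ℝ] X)) (γ : X → X)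
    (hGclosed : IsClosed ((fun A : X ≃ₗᵢ[ℝ] X =>
      (A.toLinearIsometry.toContinuousLinearMap : X →L[ℝ] X)) '' (G : Set (X ≃ₗᵢ[ℝ] X))))
    (hγinv : ∀ (x : X), ∀ A ∈ G, γ (A x) = γ x)
    (hγdecomp : ∀ x : X, ∃ A ∈ G, x = A (γ x))
    (hγineq : ∀ x w : X, ⟪x, w⟫ ≤ ⟪γ x, γ w⟫)
    (K : Set X) (hKclosed : IsClosed K) (hKconv : Convex ℝ K)
    (hKcone : ∀ x ∈ K, ∀ c : ℝ, 0 < c → c • x ∈ K)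
    (hKinv : ∀ A ∈ G, ∀ x ∈ K, A x ∈ K)
    (a b : X) (haK : a ∈ K)
    (hbK : ∀ x ∈ K, 0 ≤ ⟪b, x⟫)
    (hab : ⟪a, b⟫ = 0) :
    ∃ A ∈ G, a = A (γ a) ∧ -b = A (γ (-b)) := by
  refine exists_simultaneous_decomp_of_inner_eq G γ hγinv hγdecomp hγineq
    (le_antisymm (hγineq a (-b)) ?_)
  obtain ⟨B, hB, hb⟩ := hγdecomp (-b)
  obtain ⟨C, hC, ha⟩ := hγdecomp a
  have hBγ : B (γ a) ∈ K := by
    have hmem := hKinv B hB _ (hKinv C⁻¹ (G.inv_mem hC) a haK)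
    rwa [show C⁻¹ a = γ a from C.injective ((C.apply_symm_apply a).trans ha)] at hmem
  calc ⟪γ a, γ (-b)⟫ = ⟪B (γ a), -b⟫ := by
        rw [← B.inner_map_map, ← hb]
    _ = -⟪b, B (γ a)⟫ := by rw [inner_neg_right, real_inner_comm]
    _ ≤ 0 := neg_nonpos.mpr (hbK _ hBγ)
    _ = ⟪a, -b⟫ := by rw [inner_neg_right, hab, neg_zero]
end

section
/- Let V be a real inner product space equipped with a bilinear product ∘ that is commutative (x ∘ y = y ∘ x) and such that each multiplication operator is self-adjoint, i.e., ⟨x ∘ y, z⟩ = ⟨y, x ∘ z⟩ for all x, y, z ∈ V. If a, b ∈ V satisfy ⟨b, u ∘ (v ∘ a)⟩ = ⟨b, v ∘ (u ∘ a)⟩ for all u, v ∈ V, then the multiplication operators L_a and L_b commute: a ∘ (b ∘ x) = b ∘ (a ∘ x) for all x ∈ V. -/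
open RealInnerProductSpace

/-- Abstract core of the proof of the commutation principle (Theorem 2 of the paper):
in a real inner product space with a commutative bilinear product whose multiplication
operators are self-adjoint (e.g. a Euclidean Jordan algebra), if
`⟨b, u ∘ (v ∘ a)⟩ = ⟨b, v ∘ (u ∘ a)⟩` for all `u, v`, then the multiplication operators
`L_a` and `L_b` commute. -/
theorem mul_operators_commute
    {V : Type*} [NormedAddCommGroup V] [InnerProductSpace ℝ V]
    (mul : V →ₗ[ℝ] V →ₗ[ℝ] V)
    (hcomm : ∀ x y : V, mul x y = mul y x)
    (hself : ∀ x y z : V, ⟪mul x y, z⟫ = ⟪y, mul x z⟫)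
    (a b : V)
    (h : ∀ u v : V, ⟪b, mul u (mul v a)⟫ = ⟪b, mul v (mul u a)⟫) :
    ∀ x : V, mul a (mul b x) = mul b (mul a x) := by
  intro x
  refine ext_inner_right ℝ fun v => ?_
  calc ⟪mul a (mul b x), v⟫
      = ⟪mul x b, mul v a⟫ := by rw [hself, hcomm b x, hcomm a v]
    _ = ⟪mul v b, mul x a⟫ := by rw [hself, h, ← hself]
    _ = ⟪mul b (mul a x), v⟫ := by rw [hcomm v b, hcomm x a, hself, real_inner_comm]
end

section
/- Let X be a real inner product space, let Ω ⊆ X be a convex set, let F : X → ℝ be a convex function, and let Θ : X → ℝ be Fréchet differentiable at a point a ∈ Ω. Suppose a is a local minimizer of x ↦ Θ(x) + F(x) over Ω. Then for every c ∈ Ω with F(c) ≤ F(a), one has ⟨∇Θ(a), c − a⟩ ≥ 0. -/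
open RealInnerProductSpace

/-- If `a ∈ Ω` is a local minimizer of `Θ + F` over a convex set `Ω`, where `F` is convex
and `Θ` is Fréchet differentiable at `a` with gradient `g` (i.e. `Θ′(a) = ⟨g, ·⟩`), then
`⟨g, c - a⟩ ≥ 0` for every `c ∈ Ω` with `F(c) ≤ F(a)`. -/
theorem localMin_gradient_inner_nonneg
    {X : Type*} [NormedAddCommGroup X] [InnerProductSpace ℝ X]
    (Ω : Set X) (hΩconv : Convex ℝ Ω)
    (F : X → ℝ) (hFconv : ConvexOn ℝ Set.univ F)
    (Θ : X → ℝ) (a : X) (ha : a ∈ Ω)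
    (g : X) (hg : HasFDerivAt Θ (innerSL ℝ g : X →L[ℝ] ℝ) a)
    (hmin : IsLocalMinOn (fun x => Θ x + F x) Ω a) :
    ∀ c ∈ Ω, F c ≤ F a → 0 ≤ ⟪g, c - a⟫ := by
  intro c hc hFc
  have hS : Convex ℝ (Ω ∩ {x ∈ Set.univ | F x ≤ F a}) :=
    hΩconv.inter (hFconv.convex_le (F a))
  have hminΘ : IsLocalMinOn Θ (Ω ∩ {x ∈ Set.univ | F x ≤ F a}) a := by
    filter_upwards [hmin.on_subset Set.inter_subset_left, self_mem_nhdsWithin] with x hx hxS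
    have hFx : F x ≤ F a := hxS.2.2
    linarith
  have hcone := sub_mem_posTangentConeAt_of_segment_subset
    (hS.segment_subset ⟨ha, Set.mem_univ a, le_rfl⟩ ⟨hc, Set.mem_univ c, hFc⟩)
  simpa only [innerSL_apply_apply] using
    hminΘ.hasFDerivWithinAt_nonneg hg.hasFDerivWithinAt hcone
end

section
/- In ℝ² (with the standard inner product), let G₂ be the set of 2×2 signed permutation matrices, let a = (−1, 1), b = (3, −2), and let Ω be the convex hull of { A a : A ∈ G₂ }. Then: (i) a minimizes the linear function x ↦ ⟨b, x⟩ over Ω, i.e., ⟨b, a⟩ ≤ ⟨b, x⟩ for all x ∈ Ω; (ii) there exists A ∈ G₂ with a = A (1, 1) and −b = A (3, 2); (iii) there is no A ∈ G₂ with a = A (1, 1) and b = A (3, 2). (Here (1, 1) = γ(a) and (3, 2) = γ(b) = γ(−b), where γ(x) is the vector of absolute values of the entries of x arranged in decreasing order; thus a commutes with −b but not with b in the normal decomposition system (ℝ², G₂, γ).) -/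
open Matrix

/-- A `2 × 2` real matrix is a signed permutation matrix if it has exactly one nonzero
entry in each row and each column, and each nonzero entry is `1` or `-1`. -/
def IsSignedPerm (M : Matrix (Fin 2) (Fin 2) ℝ) : Prop :=
  ∃ σ : Equiv.Perm (Fin 2), ∃ ε : Fin 2 → ℝ,
    (∀ i, ε i = 1 ∨ ε i = -1) ∧ ∀ i j, M i j = if j = σ i then ε i else 0

/-- A signed permutation matrix permutes the entries of a vector and changes their signs. -/
theorem IsSignedPerm.exists_mulVec_eq {M : Matrix (Fin 2) (Fin 2) ℝ} (hM : IsSignedPerm M) :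
    ∃ σ : Equiv.Perm (Fin 2), ∃ ε : Fin 2 → ℝ, (∀ i, ε i = 1 ∨ ε i = -1) ∧
      ∀ v i, M.mulVec v i = ε i * v (σ i) := by
  obtain ⟨σ, ε, hε, h⟩ := hM
  exact ⟨σ, ε, hε, fun v i => by simp [Matrix.mulVec, dotProduct, h]⟩

theorem IsSignedPerm.abs_mulVec_apply {M : Matrix (Fin 2) (Fin 2) ℝ} (hM : IsSignedPerm M)
    {v : Fin 2 → ℝ} {c : ℝ} (hv : ∀ j, |v j| = c) (i : Fin 2) : |M.mulVec v i| = c := by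
  obtain ⟨σ, ε, hε, h⟩ := hM.exists_mulVec_eq
  rw [h, abs_mul, hv]
  rcases hε i with h | h <;> simp [h]

/-- **Remark 7 of the paper.** In the normal decomposition system `(ℝ², G₂, γ)` where `G₂`
is the group of `2 × 2` signed permutation matrices and `γ(x) = |x|↓`, the point
`a = (-1, 1)` minimizes `x ↦ ⟨b, x⟩` (with `b = (3, -2)`) over the convex hull `Ω` of the
`G₂`-orbit of `a`; moreover `a` commutes with `-b` (via `γ(a) = (1,1)`, `γ(-b) = (3,2)`)
but `a` does not commute with `b`. -/
theorem signed_perm_example :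
    (∀ x ∈ convexHull ℝ {y : Fin 2 → ℝ | ∃ M : Matrix (Fin 2) (Fin 2) ℝ,
        IsSignedPerm M ∧ y = M.mulVec ![(-1 : ℝ), 1]},
      ![(3 : ℝ), -2] ⬝ᵥ ![(-1 : ℝ), 1] ≤ ![(3 : ℝ), -2] ⬝ᵥ x) ∧
    (∃ M : Matrix (Fin 2) (Fin 2) ℝ, IsSignedPerm M ∧
      ![(-1 : ℝ), 1] = M.mulVec ![(1 : ℝ), 1] ∧
      -![(3 : ℝ), -2] = M.mulVec ![(3 : ℝ), 2]) ∧
    ¬ (∃ M : Matrix (Fin 2) (Fin 2) ℝ, IsSignedPerm M ∧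
      ![(-1 : ℝ), 1] = M.mulVec ![(1 : ℝ), 1] ∧
      ![(3 : ℝ), -2] = M.mulVec ![(3 : ℝ), 2]) := by
  refine ⟨fun x hx => ?_, ⟨!![-1, 0; 0, 1], ⟨1, ![-1, 1], ?_, ?_⟩, ?_, ?_⟩, ?_⟩
  · refine convexHull_min ?_ (convex_halfSpace_ge
      (f := fun x => ![(3 : ℝ), -2] ⬝ᵥ x) ⟨dotProduct_add _, fun c => dotProduct_smul c _⟩ _) hx
    rintro y ⟨M, hM, rfl⟩
    have hy : ∀ i, |M.mulVec ![(-1 : ℝ), 1] i| = 1 :=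
      hM.abs_mulVec_apply fun j => by fin_cases j <;> simp
    have h₀ := (abs_le.mp (hy 0).le).1
    have h₁ := (abs_le.mp (hy 1).le).2
    generalize M.mulVec ![(-1 : ℝ), 1] = y at *
    simp only [Set.mem_ofPred_eq, dotProduct, Fin.sum_univ_two, Matrix.cons_val_zero,
      Matrix.cons_val_one]
    linarith
  · simp [Fin.forall_fin_two]
  · simp [Fin.forall_fin_two]
  · ext i; fin_cases i <;> simp [Matrix.mulVec, dotProduct]
  · ext i; fin_cases i <;> simp [Matrix.mulVec, dotProduct]
  · rintro ⟨M, hM, ha, hb⟩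
    obtain ⟨σ, ε, -, h⟩ := hM.exists_mulVec_eq
    have ha₀ := congrFun ha 0
    have hb₀ := congrFun hb 0
    rw [h] at ha₀ hb₀
    generalize σ 0 = j at *
    fin_cases j <;> norm_num at ha₀ hb₀ <;> linarith
end

section
/- Let S^n be the space of n×n real symmetric matrices with the trace (Frobenius) inner product ⟨X, Y⟩ = tr(XY). Let Ω ⊆ S^n satisfy U Ω Uᵀ ⊆ Ω for every n×n real orthogonal matrix U, let F : S^n → ℝ satisfy F(U X Uᵀ) = F(X) for every X ∈ S^n and every orthogonal U, and let Θ : S^n → ℝ be Fréchet differentiable. If A ∈ Ω is a local minimizer of X ↦ Θ(X) + F(X) over Ω, then A commutes with the gradient of Θ at A: A · ∇Θ(A) = ∇Θ(A) · A. -/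
open Matrix

attribute [local instance] Matrix.normedAddCommGroup Matrix.normedSpace

theorem hasDerivAt_exp_smul_zero {𝔸 : Type*} [NormedRing 𝔸] [NormedAlgebra ℝ 𝔸]
    [FiniteDimensional ℝ 𝔸] (x : 𝔸) :
    HasDerivAt (fun t : ℝ => NormedSpace.exp (t • x)) x 0 := by
  have := FiniteDimensional.complete ℝ 𝔸
  simpa using hasDerivAt_exp_smul_const (𝕂 := ℝ) x (0 : ℝ)

/-- Every skew-symmetric matrix is the velocity at the identity of a curve of orthogonal
matrices. -/
theorem exists_orthogonal_curve_hasDerivAt {n : ℕ} (K : Matrix (Fin n) (Fin n) ℝ)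
    (hK : Kᵀ = -K) :
    ∃ U : ℝ → Matrix (Fin n) (Fin n) ℝ, (∀ t, U t ∈ Matrix.orthogonalGroup (Fin n) ℝ) ∧
      U 0 = 1 ∧ HasDerivAt U K 0 := by
  refine ⟨fun t => NormedSpace.exp (t • K), fun t => ?_, by simp, ?_⟩
  · rw [Matrix.mem_orthogonalGroup_iff, ← Matrix.exp_transpose, transpose_smul, hK, smul_neg,
      ← Matrix.exp_add_of_commute _ _ (Commute.neg_right (Commute.refl (t • K)))]
    simp
  · have h : ∀ i j, HasDerivAt (fun t : ℝ => NormedSpace.exp (t • K) i j) (K i j) 0 := by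
      intro i j
      let _ : NormedRing (Matrix (Fin n) (Fin n) ℝ) := Matrix.linftyOpNormedRing
      let _ : NormedAlgebra ℝ (Matrix (Fin n) (Fin n) ℝ) := Matrix.linftyOpNormedAlgebra
      exact ((Matrix.entryLinearMap ℝ ℝ i j).toContinuousLinearMap.hasFDerivAt).comp_hasDerivAt
        0 (hasDerivAt_exp_smul_zero K)
    exact hasDerivAt_pi.2 fun i => hasDerivAt_pi.2 fun j => h i j

/-- The derivative at the identity of the orbit map `U ↦ U A Uᵀ` along a curve with
skew-symmetric velocity `K` is the commutator `K A - A K`. -/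
theorem hasDerivAt_conj_transpose {n : ℕ} {U : ℝ → Matrix (Fin n) (Fin n) ℝ}
    {K : Matrix (Fin n) (Fin n) ℝ} (hK : Kᵀ = -K) (hU0 : U 0 = 1) (hU : HasDerivAt U K 0)
    (A : Matrix (Fin n) (Fin n) ℝ) :
    HasDerivAt (fun t => U t * A * (U t)ᵀ) (K * A - A * K) 0 := by
  have hentry : ∀ i j, HasDerivAt (fun t => U t i j) (K i j) 0 := fun i j =>
    hasDerivAt_pi.1 (hasDerivAt_pi.1 hU i) j
  refine hasDerivAt_pi.2 fun i => hasDerivAt_pi.2 fun j => ?_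
  have h := HasDerivAt.fun_sum (u := Finset.univ) fun k _ =>
    (HasDerivAt.fun_sum (u := Finset.univ) fun l _ => (hentry i l).mul_const (A l k)).mul
      (hentry j k)
  have hA : K * A - A * K = K * A * (U 0)ᵀ + U 0 * A * Kᵀ := by
    rw [hU0, hK]; simp [sub_eq_add_neg]
  rw [hA]
  convert h using 1
  · simp [Matrix.mul_apply]
  · rw [Matrix.add_apply, Matrix.mul_apply, Matrix.mul_apply, Finset.sum_add_distrib]
    simp only [Matrix.mul_apply, Matrix.transpose_apply]

/-- **Theorem 2 of the paper, specialized to the algebra `Sⁿ` of real symmetric matrices**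
(with the trace inner product `⟨X, Y⟩ = tr (X Y)`). Let `Ω ⊆ Sⁿ` and `F : Sⁿ → ℝ` be
invariant under the automorphisms `X ↦ U X Uᵀ` (`U` orthogonal), and let `Θ` be Fréchet
differentiable on `Sⁿ`, with gradient `B` at `A` (the symmetric matrix representing
`Θ′(A)` via `Θ′(A) H = tr (B H)` for symmetric `H`).  If `A ∈ Ω` is a local minimizer of
`Θ + F` over `Ω`, then `A` commutes with `B = ∇Θ(A)`. -/
theorem commutation_principle_symm_matrices {n : ℕ}
    (Ω : Set (Matrix (Fin n) (Fin n) ℝ))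
    (hΩsymm : ∀ X ∈ Ω, X.IsSymm)
    (hΩinv : ∀ U ∈ Matrix.orthogonalGroup (Fin n) ℝ, ∀ X ∈ Ω, U * X * Uᵀ ∈ Ω)
    (F : Matrix (Fin n) (Fin n) ℝ → ℝ)
    (hFinv : ∀ U ∈ Matrix.orthogonalGroup (Fin n) ℝ,
      ∀ X : Matrix (Fin n) (Fin n) ℝ, X.IsSymm → F (U * X * Uᵀ) = F X)
    (Θ : Matrix (Fin n) (Fin n) ℝ → ℝ)
    (hΘdiff : ∀ X ∈ {Y : Matrix (Fin n) (Fin n) ℝ | Y.IsSymm},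
      DifferentiableWithinAt ℝ Θ {Y : Matrix (Fin n) (Fin n) ℝ | Y.IsSymm} X)
    (A : Matrix (Fin n) (Fin n) ℝ) (hA : A ∈ Ω)
    (B : Matrix (Fin n) (Fin n) ℝ) (hBsymm : B.IsSymm)
    (L : Matrix (Fin n) (Fin n) ℝ →L[ℝ] ℝ)
    (hL : HasFDerivWithinAt Θ L {Y : Matrix (Fin n) (Fin n) ℝ | Y.IsSymm} A)
    (hLB : ∀ H : Matrix (Fin n) (Fin n) ℝ, H.IsSymm → L H = (B * H).trace)
    (hmin : IsLocalMinOn (fun X => Θ X + F X) Ω A) :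
    A * B = B * A := by
  have hAs : Aᵀ = A := hΩsymm A hA
  have hBs : Bᵀ = B := hBsymm
  set K := A * B - B * A with hKdef
  have hK : Kᵀ = -K := by
    simp [hKdef, transpose_sub, transpose_mul, hAs, hBs]
  obtain ⟨U, hUorth, hU0, hU⟩ := exists_orthogonal_curve_hasDerivAt K hK
  have hcurve := hasDerivAt_conj_transpose hK hU0 hU A
  have hstart : U 0 * A * (U 0)ᵀ = A := by simp [hU0]
  have hmem : ∀ t, U t * A * (U t)ᵀ ∈ Ω := fun t => hΩinv _ (hUorth t) A hA
  have hderiv : HasDerivAt (fun t => Θ (U t * A * (U t)ᵀ)) (L (K * A - A * K)) 0 := by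
    refine HasFDerivWithinAt.comp_hasDerivAt (x := (0 : ℝ)) (t := {Y | Y.IsSymm}) ?_ hcurve
      (.of_forall fun t => hΩsymm _ (hmem t))
    rw [hstart]
    exact hL
  have hlocal : IsLocalMin (fun t => Θ (U t * A * (U t)ᵀ)) 0 := by
    have htend : Filter.Tendsto (fun t => U t * A * (U t)ᵀ) (nhds 0) (nhdsWithin A Ω) := by
      refine tendsto_nhdsWithin_iff.2 ⟨?_, .of_forall hmem⟩
      have h := hcurve.continuousAt.tendsto
      rw [hstart] at h
      exact h
    filter_upwards [htend.eventually hmin] with t ht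
    rw [hFinv _ (hUorth t) A hAs] at ht
    rw [hstart]
    linarith
  have hzero := hlocal.hasDerivAt_eq_zero hderiv
  have hsymm : (K * A - A * K).IsSymm := by
    simp [Matrix.IsSymm, transpose_sub, transpose_mul, hAs, hK, neg_add_eq_sub]
  rw [hLB _ hsymm] at hzero
  have htrace : (Kᵀ * K).trace = 0 := by
    have : (B * (K * A - A * K)).trace = (K * K).trace := by
      rw [mul_sub, trace_sub, ← mul_assoc, trace_mul_comm (B * K), ← mul_assoc, ← mul_assoc,
        ← trace_sub, ← sub_mul]
    rw [hK, neg_mul, trace_neg, ← this, hzero, neg_zero]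
  have hKzero : K = 0 := by
    rwa [← conjTranspose_eq_transpose_of_trivial, trace_conjTranspose_mul_self_eq_zero_iff]
      at htrace
  exact sub_eq_zero.1 hKzero
end

section
/- Let S^n be the space of n×n real symmetric matrices with the trace (Frobenius) inner product ⟨X, Y⟩ = tr(XY). Let Ω ⊆ S^n satisfy U Ω Uᵀ ⊆ Ω for every n×n real orthogonal matrix U, let F : S^n → ℝ satisfy F(U X Uᵀ) = F(X) for every X ∈ S^n and every orthogonal U, and let H : S^n → S^n be an arbitrary map. If A ∈ Ω solves the variational inequality ⟨H(A), X − A⟩ + F(X) − F(A) ≥ 0 for all X ∈ Ω, then A commutes with H(A): A · H(A) = H(A) · A. -/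
open Matrix

/-- The exponential of a real skew-symmetric matrix is orthogonal. -/
theorem exp_mem_orthogonalGroup_of_transpose_eq_neg {m : Type*} [Fintype m] [DecidableEq m]
    {K : Matrix m m ℝ} (hK : Kᵀ = -K) :
    NormedSpace.exp K ∈ Matrix.orthogonalGroup m ℝ := by
  rw [Matrix.mem_orthogonalGroup_iff, ← Matrix.exp_transpose, hK,
    ← Matrix.exp_add_of_commute _ _ (Commute.neg_right (Commute.refl K)), add_neg_cancel,
    NormedSpace.exp_zero]

section

attribute [local instance] Matrix.linftyOpNormedRing Matrix.linftyOpNormedAlgebra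

/-- The derivative at `0` of the trace pairing of `B` with the conjugates of `A` along the
one-parameter group generated by `K`. -/
theorem hasDerivAt_trace_mul_exp_conj {m : Type*} [Fintype m] [DecidableEq m]
    (A B K : Matrix m m ℝ) :
    HasDerivAt (fun t : ℝ => (B * (NormedSpace.exp (t • K) * A * NormedSpace.exp (t • -K))).trace)
      (K * (A * B - B * A)).trace 0 := by
  have h₁ := hasDerivAt_exp_smul_const (𝕂 := ℝ) K (0 : ℝ)
  have h₂ := hasDerivAt_exp_smul_const (𝕂 := ℝ) (-K) (0 : ℝ)
  have h := ((h₁.mul_const A).mul h₂).const_mul B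
  have htr := (LinearMap.toContinuousLinearMap
    (Matrix.traceLinearMap m ℝ ℝ)).hasFDerivAt.comp_hasDerivAt (0 : ℝ) h
  refine htr.congr_deriv ?_
  change Matrix.trace (B * (NormedSpace.exp ((0 : ℝ) • K) * K * A * NormedSpace.exp ((0 : ℝ) • -K) +
    NormedSpace.exp ((0 : ℝ) • K) * A * (NormedSpace.exp ((0 : ℝ) • -K) * -K))) = _
  simp only [zero_smul, NormedSpace.exp_zero, one_mul, mul_one, mul_add, mul_sub, mul_neg, Matrix.trace_add,
    Matrix.trace_sub, Matrix.trace_neg]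
  rw [← Matrix.mul_assoc B K A, Matrix.trace_mul_cycle B K A, Matrix.trace_mul_comm (A * B) K,
    ← Matrix.mul_assoc B A K, Matrix.trace_mul_comm (B * A) K]
  ring

end

/-- If `A` minimizes the trace pairing with `B` over its orthogonal conjugates, then the symmetric
matrices `A` and `B` commute. -/
theorem mul_comm_of_trace_le_orthogonal_conj {m : Type*} [Fintype m] [DecidableEq m]
    {A B : Matrix m m ℝ} (hA : A.IsSymm) (hB : B.IsSymm)
    (hmin : ∀ U ∈ Matrix.orthogonalGroup m ℝ, (B * A).trace ≤ (B * (U * A * Uᵀ)).trace) :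
    A * B = B * A := by
  set K := A * B - B * A with hKdef
  have hK : Kᵀ = -K := by
    rw [hKdef, Matrix.transpose_sub, Matrix.transpose_mul, Matrix.transpose_mul, hA.eq, hB.eq,
      neg_sub]
  have hloc : IsLocalMin (fun t : ℝ =>
      (B * (NormedSpace.exp (t • K) * A * NormedSpace.exp (t • -K))).trace) 0 := by
    refine Filter.Eventually.of_forall fun t => ?_
    have htK : (t • K)ᵀ = -(t • K) := by rw [Matrix.transpose_smul, hK, smul_neg]
    have h := hmin _ (exp_mem_orthogonalGroup_of_transpose_eq_neg htK)
    rw [← Matrix.exp_transpose, htK, ← smul_neg] at h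
    simpa using h
  have h0 := hloc.hasDerivAt_eq_zero (hasDerivAt_trace_mul_exp_conj A B K)
  have h1 : (Kᴴ * K).trace = 0 := by
    rw [Matrix.conjTranspose_eq_transpose_of_trivial, hK, neg_mul, Matrix.trace_neg, h0, neg_zero]
  exact sub_eq_zero.mp (Matrix.trace_conjTranspose_mul_self_eq_zero_iff.mp h1)

/-- **Theorem 4 of the paper, specialized to the algebra `Sⁿ` of real symmetric matrices**
(with the trace inner product `⟨X, Y⟩ = tr (X Y)`). If `Ω ⊆ Sⁿ` and `F : Sⁿ → ℝ` are
invariant under the automorphisms `X ↦ U X Uᵀ` (`U` orthogonal) and `A ∈ Ω` solves the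
variational inequality `VI(H, Ω, F)`, then `A` commutes with `H(A)`. -/
theorem variational_inequality_symm_matrices {n : ℕ}
    (Ω : Set (Matrix (Fin n) (Fin n) ℝ))
    (hΩsymm : ∀ X ∈ Ω, X.IsSymm)
    (hΩinv : ∀ U ∈ Matrix.orthogonalGroup (Fin n) ℝ, ∀ X ∈ Ω, U * X * Uᵀ ∈ Ω)
    (F : Matrix (Fin n) (Fin n) ℝ → ℝ)
    (hFinv : ∀ U ∈ Matrix.orthogonalGroup (Fin n) ℝ,
      ∀ X : Matrix (Fin n) (Fin n) ℝ, X.IsSymm → F (U * X * Uᵀ) = F X)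
    (H : Matrix (Fin n) (Fin n) ℝ → Matrix (Fin n) (Fin n) ℝ)
    (hHsymm : ∀ X : Matrix (Fin n) (Fin n) ℝ, X.IsSymm → (H X).IsSymm)
    (A : Matrix (Fin n) (Fin n) ℝ) (hA : A ∈ Ω)
    (hVI : ∀ X ∈ Ω, 0 ≤ (H A * (X - A)).trace + F X - F A) :
    A * H A = H A * A := by
  refine mul_comm_of_trace_le_orthogonal_conj (hΩsymm A hA) (hHsymm A (hΩsymm A hA)) fun U hU => ?_
  have h := hVI _ (hΩinv U hU A hA)
  rw [hFinv U hU A (hΩsymm A hA), mul_sub, Matrix.trace_sub] at h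
  linarith
end
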